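/- Let K/k be a finite Galois extension of degree ℓ ≥ m whose Galois group is cyclic, generated by θ, let v ∈ K^m be a Gabidulin vector and 1 ≤ d < m. Then every nonzero element c of C̃(v,θ,d) has rank at least m − d + 1 (i.e., the k-span of the entries of c has k-dimension at least m − d + 1), and there exists a nonzero element of C̃(v,θ,d) of rank exactly m − d + 1. In particular Gabidulin-like codes are MRD codes. -/

import Mathlib

/-- The Gabidulin-like code `C̃(v,θ,d) = span_K{v, θ(v), …, θ^{d−1}(v)} ≤ K^m`,
where `θ` acts entrywise on `K^m`. -/
def gabCode {k K : Type*} [Field k] [Field K] [Algebra k K] {m : ℕ}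
    (θ : K ≃ₐ[k] K) (v : Fin m → K) (d : ℕ) : Submodule K (Fin m → K) :=
  Submodule.span K (Set.range fun i : Fin d => (fun j => (θ ^ (i : ℕ)) (v j) : Fin m → K))

/-- An element fixed by a generator of the Galois group lies in the base field. -/
theorem mem_range_algebraMap_of_fixed_generator {k K : Type*} [Field k] [Field K] [Algebra k K]
    [FiniteDimensional k K] [IsGalois k K]
    {θ : K ≃ₐ[k] K} (hθ : ∀ σ : K ≃ₐ[k] K, σ ∈ Subgroup.zpowers θ)
    {x : K} (hx : θ x = x) : x ∈ Set.range (algebraMap k K) := by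
  rw [IsGalois.mem_range_algebraMap_iff_fixed]
  intro σ
  have h : Subgroup.zpowers θ ≤ MulAction.stabilizer (K ≃ₐ[k] K) x :=
    Subgroup.zpowers_le.2 hx
  exact h (hθ σ)

/-- A `θ`-polynomial with `n` coefficients that vanishes on `n` elements linearly independent
over the base field has only zero coefficients. -/
theorem coeff_eq_zero_of_linearIndependent_roots {k K : Type*} [Field k] [Field K] [Algebra k K]
    [FiniteDimensional k K] [IsGalois k K]
    {θ : K ≃ₐ[k] K} (hθ : ∀ σ : K ≃ₐ[k] K, σ ∈ Subgroup.zpowers θ) (n : ℕ) :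
    ∀ (a : ℕ → K) (w : Fin n → K), LinearIndependent k w →
      (∀ j, ∑ i ∈ Finset.range n, a i * (θ ^ i) (w j) = 0) → ∀ i < n, a i = 0 := by
  induction n with
  | zero => intro a w _ _ i hi; omega
  | succ n ih =>
    intro a w hw h
    have hw0 : w 0 ≠ 0 := hw.ne_zero 0
    set b : ℕ → K := fun i => a i * (θ ^ i) (w 0) with hb
    set u : Fin (n + 1) → K := fun j => (w 0)⁻¹ * w j with hu
    have hu0 : u 0 = 1 := inv_mul_cancel₀ hw0
    have hui : LinearIndependent k u :=
      hw.map' (LinearMap.mulLeft k (w 0)⁻¹)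
        (LinearMap.ker_eq_bot.2 (mul_right_injective₀ (inv_ne_zero hw0)))
    have hbu : ∀ j, ∑ i ∈ Finset.range (n + 1), b i * (θ ^ i) (u j) = 0 := by
      intro j
      rw [← h j]
      refine Finset.sum_congr rfl fun i _ => ?_
      rw [hb, hu]
      simp only
      rw [mul_assoc, ← map_mul, mul_inv_cancel_left₀ hw0]
    have hsum : ∑ i ∈ Finset.range (n + 1), b i = 0 := by
      simpa [hu0] using hbu 0
    have hdiff : LinearIndependent k fun j : Fin n => θ (u j.succ) - u j.succ := by
      rw [Fintype.linearIndependent_iff]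
      intro g hg
      have hfix : θ (∑ j, g j • u j.succ) = ∑ j, g j • u j.succ := by
        rw [← sub_eq_zero, ← hg, map_sum, ← Finset.sum_sub_distrib]
        exact Finset.sum_congr rfl fun j _ => by rw [map_smul, smul_sub]
      obtain ⟨r, hr⟩ := mem_range_algebraMap_of_fixed_generator hθ hfix
      have hrel := Fintype.linearIndependent_iff.1 hui (Fin.cons (-r) g) (by
        rw [Fin.sum_univ_succ]
        simp only [Fin.cons_zero, Fin.cons_succ, hu0, ← hr, neg_smul, Algebra.smul_def r, mul_one,
          neg_add_cancel])
      intro j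
      simpa using hrel j.succ
    have hpartial : ∀ i < n, ∑ l ∈ Finset.range (i + 1), b l = 0 := by
      refine ih (fun i => ∑ l ∈ Finset.range (i + 1), b l) _ hdiff fun j => ?_
      have hparts := Finset.sum_range_by_parts (fun i => (θ ^ i) (u j.succ)) b (n + 1)
      simp only [smul_eq_mul, hsum, mul_zero, zero_sub, Nat.add_sub_cancel] at hparts
      have hz := hbu j.succ
      simp only [mul_comm (b _)] at hz
      rw [hz, eq_comm, neg_eq_zero] at hparts
      rw [← hparts]
      refine Finset.sum_congr rfl fun i _ => ?_
      rw [map_sub, mul_comm, pow_succ, AlgEquiv.mul_apply]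
    have hall : ∀ i ≤ n + 1, ∑ l ∈ Finset.range i, b l = 0 := by
      intro i hi
      rcases i with _ | i
      · simp
      · rcases Nat.lt_or_ge i n with hin | hin
        · exact hpartial i hin
        · rw [show i = n by omega]; exact hsum
    intro i hi
    have hbi : b i = 0 := by
      have h1 := hall (i + 1) (by omega)
      rwa [Finset.sum_range_succ, hall i (by omega), zero_add] at h1
    exact (mul_eq_zero.1 hbi).resolve_right
      ((map_ne_zero_iff _ (θ ^ i).injective).2 hw0)

/-- The codewords of `gabCode θ v d` are the evaluations at `v` of the `θ`-polynomials
with `d` coefficients. -/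
theorem mem_gabCode_iff {k K : Type*} [Field k] [Field K] [Algebra k K] {m : ℕ}
    {θ : K ≃ₐ[k] K} {v : Fin m → K} {d : ℕ} {c : Fin m → K} :
    c ∈ gabCode θ v d ↔
      ∃ a : ℕ → K, c = fun j => ∑ i ∈ Finset.range d, a i * (θ ^ i) (v j) := by
  rw [gabCode, Submodule.mem_span_range_iff_exists_fun]
  constructor
  · rintro ⟨a, rfl⟩
    refine ⟨fun i => if h : i < d then a ⟨i, h⟩ else 0, ?_⟩
    ext j
    simp [Finset.sum_range]
  · rintro ⟨a, rfl⟩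
    refine ⟨fun i => a i, ?_⟩
    ext j
    simp [Finset.sum_range]

/-- Nonzero codewords of `gabCode θ v d` have rank at least `m - d + 1`. -/
theorem le_finrank_span_of_mem_gabCode {k K : Type*} [Field k] [Field K] [Algebra k K]
    [FiniteDimensional k K] [IsGalois k K]
    {θ : K ≃ₐ[k] K} (hθ : ∀ σ : K ≃ₐ[k] K, σ ∈ Subgroup.zpowers θ)
    {m : ℕ} {v : Fin m → K}
    (hv : Module.finrank k (Submodule.span k (Set.range v)) = m) {d : ℕ} (hdm : d < m)
    {c : Fin m → K} (hc : c ∈ gabCode θ v d) (hc0 : c ≠ 0) :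
    m - d + 1 ≤ Module.finrank k (Submodule.span k (Set.range c)) := by
  obtain ⟨a, rfl⟩ := mem_gabCode_iff.1 hc
  set T : K →ₗ[k] K :=
    ∑ i ∈ Finset.range d, (LinearMap.mulLeft k (a i)).comp (θ ^ i).toLinearMap with hT
  have hTx : ∀ x, T x = ∑ i ∈ Finset.range d, a i * (θ ^ i) x := by
    intro x
    simp [hT]
  clear_value T
  have hmap : Submodule.span k (Set.range fun j => ∑ i ∈ Finset.range d, a i * (θ ^ i) (v j)) =
      LinearMap.range (T.domRestrict (Submodule.span k (Set.range v))) := by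
    rw [LinearMap.range_domRestrict, Submodule.map_span, ← Set.range_comp]
    congr 2
    ext j
    simp [hTx]
  have hker : Module.finrank k
      (LinearMap.ker (T.domRestrict (Submodule.span k (Set.range v)))) < d := by
    by_contra! hle
    obtain ⟨f, hf⟩ := exists_linearIndependent_of_le_finrank hle
    have hf' : LinearIndependent k
        fun j => ((f j : Submodule.span k (Set.range v)) : K) :=
      hf.map_injOn ((Submodule.subtype _).comp (Submodule.subtype _))
        (Subtype.val_injective.comp Subtype.val_injective).injOn
    have hTf : ∀ j, T ((f j : Submodule.span k (Set.range v)) : K) = 0 := fun j =>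
      LinearMap.mem_ker.1 (f j).2
    have ha := coeff_eq_zero_of_linearIndependent_roots hθ d a _ hf'
      fun j => (hTx _).symm.trans (hTf j)
    refine hc0 (funext fun j => Finset.sum_eq_zero fun i hi => ?_)
    rw [ha i (Finset.mem_range.1 hi), zero_mul]
  have hrk := LinearMap.finrank_range_add_finrank_ker
    (T.domRestrict (Submodule.span k (Set.range v)))
  rw [hv] at hrk
  rw [hmap]
  omega

/-- Some nonzero codeword of `gabCode θ v d` has its first `d - 1` entries equal to zero. -/
theorem exists_mem_gabCode_ne_zero_of_lt {k K : Type*} [Field k] [Field K] [Algebra k K]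
    [FiniteDimensional k K] [IsGalois k K]
    {θ : K ≃ₐ[k] K} (hθ : ∀ σ : K ≃ₐ[k] K, σ ∈ Subgroup.zpowers θ)
    {m : ℕ} {v : Fin m → K} (hv : LinearIndependent k v)
    {d : ℕ} (hd1 : 1 ≤ d) (hdm : d < m) :
    ∃ c ∈ gabCode θ v d, c ≠ 0 ∧ ∀ j : Fin m, (j : ℕ) < d - 1 → c j = 0 := by
  let M : Matrix (Fin (d - 1)) (Fin d) K :=
    fun j i => (θ ^ (i : ℕ)) (v ⟨j, by omega⟩)
  have hM : LinearMap.ker M.mulVecLin ≠ ⊥ :=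
    LinearMap.ker_ne_bot_of_finrank_lt (by simp only [Module.finrank_fin_fun]; omega)
  obtain ⟨x, hx, hx0⟩ := Submodule.exists_mem_ne_zero_of_ne_bot hM
  let a : ℕ → K := fun i => if h : i < d then x ⟨i, h⟩ else 0
  have hax : ∀ i : Fin d, a i = x i := fun i => by simp [a]
  refine ⟨_, mem_gabCode_iff.2 ⟨a, rfl⟩, fun h0 => hx0 (funext fun i => ?_), fun j hj => ?_⟩
  · rw [← hax, Pi.zero_apply]
    exact coeff_eq_zero_of_linearIndependent_roots hθ d a (v ∘ Fin.castLE hdm.le)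
      (hv.comp _ (Fin.castLE_injective _)) (fun j => congrFun h0 _) i i.2
  · have hxj := congrFun (LinearMap.mem_ker.1 hx) ⟨j, hj⟩
    rw [Finset.sum_range, ← Pi.zero_apply (M := fun _ : Fin (d - 1) => K) ⟨j, hj⟩, ← hxj]
    exact Finset.sum_congr rfl fun i _ => by rw [hax, mul_comm]

/-- A vector of length `m` whose first `s` entries vanish has rank at most `m - s`. -/
theorem finrank_span_range_le_of_lt_eq_zero {k V : Type*} [DivisionRing k] [AddCommGroup V]
    [Module k V] {m s : ℕ} {c : Fin m → V} (hc : ∀ j : Fin m, (j : ℕ) < s → c j = 0) :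
    Module.finrank k (Submodule.span k (Set.range c)) ≤ m - s := by
  let e : Fin (m - s) → V := fun j => c ⟨j + s, by omega⟩
  have hle : Submodule.span k (Set.range c) ≤ Submodule.span k (Set.range e) := by
    rw [Submodule.span_le]
    rintro _ ⟨j, rfl⟩
    rcases Nat.lt_or_ge j s with hj | hj
    · rw [hc j hj]
      exact Submodule.zero_mem _
    · refine Submodule.subset_span ⟨⟨j - s, by omega⟩, ?_⟩
      simp only [e, Nat.sub_add_cancel hj]
  have : FiniteDimensional k (Submodule.span k (Set.range e)) :=
    FiniteDimensional.span_of_finite k (Set.finite_range e)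
  refine (Submodule.finrank_mono hle).trans ?_
  simpa [Set.finrank] using finrank_range_le_card (R := k) e

/-- Let `K/k` be a finite Galois extension of degree `ℓ ≥ m` with cyclic Galois group
generated by `θ`, let `v ∈ K^m` be a Gabidulin vector and `1 ≤ d < m`.  Then every
nonzero `c ∈ C̃(v,θ,d)` has rank (the `k`-dimension of the `k`-span of its entries)
at least `m − d + 1`, and some nonzero element has rank exactly `m − d + 1`:
Gabidulin-like codes are MRD codes. -/
theorem gabCode_is_MRD {k K : Type*} [Field k] [Field K] [Algebra k K]
    [FiniteDimensional k K] [IsGalois k K]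
    (θ : K ≃ₐ[k] K) (hθ : ∀ σ : K ≃ₐ[k] K, σ ∈ Subgroup.zpowers θ)
    {m : ℕ} (hml : m ≤ Module.finrank k K) (v : Fin m → K)
    (hv : Module.finrank k (Submodule.span k (Set.range v)) = m)
    (d : ℕ) (hd1 : 1 ≤ d) (hdm : d < m) :
    (∀ c ∈ gabCode θ v d, c ≠ 0 →
        m - d + 1 ≤ Module.finrank k (Submodule.span k (Set.range c))) ∧
    (∃ c ∈ gabCode θ v d, c ≠ 0 ∧
        Module.finrank k (Submodule.span k (Set.range c)) = m - d + 1) := by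
  refine ⟨fun c hc hc0 => le_finrank_span_of_mem_gabCode hθ hv hdm hc hc0, ?_⟩
  have hvi : LinearIndependent k v := by
    rw [linearIndependent_iff_card_eq_finrank_span, Set.finrank, hv, Fintype.card_fin]
  obtain ⟨c, hc, hc0, hzero⟩ := exists_mem_gabCode_ne_zero_of_lt hθ hvi hd1 hdm
  refine ⟨c, hc, hc0, le_antisymm ?_ (le_finrank_span_of_mem_gabCode hθ hv hdm hc hc0)⟩
  have := finrank_span_range_le_of_lt_eq_zero (k := k) hzero
  omega
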